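/- Let q, d ≥ 1 be integers and let γ = (γ₁, …, γ_q) : S¹ → U(d)^q be a continuous loop. The composite of γ with the quotient map U(d)^q → U(d)^q/ΔU(d) is nullhomotopic if and only if the winding numbers of the loops det∘γ₁, …, det∘γ_q : S¹ → S¹ are all equal. -/

import Mathlib

/-- The diagonal subgroup `ΔU(d) = {(v, v, …, v) : v ∈ U(d)}` of the product group `U(d)^q`. -/
def diagonalUnitary (q d : ℕ) : Subgroup (Fin q → Matrix.unitaryGroup (Fin d) ℂ) where
  carrier := {u | ∃ v : Matrix.unitaryGroup (Fin d) ℂ, u = fun _ => v}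
  one_mem' := ⟨1, rfl⟩
  mul_mem' := by
    rintro a b ⟨v, rfl⟩ ⟨w, rfl⟩
    exact ⟨v * w, rfl⟩
  inv_mem' := by
    rintro a ⟨v, rfl⟩
    exact ⟨v⁻¹, rfl⟩

/-- The determinant of a unitary matrix, as an element of the circle group. -/
noncomputable def detCircle (d : ℕ) (u : Matrix.unitaryGroup (Fin d) ℂ) : Circle :=
  ⟨(u : Matrix (Fin d) (Fin d) ℂ).det, by
    have h := Matrix.det_of_mem_unitary u.prop
    have h2 := h.2
    rw [Complex.star_def, Complex.mul_conj] at h2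
    have h3 : Complex.normSq (u : Matrix (Fin d) (Fin d) ℂ).det = 1 := by exact_mod_cast h2
    have : ‖(u : Matrix (Fin d) (Fin d) ℂ).det‖ = 1 := by
      rw [Complex.norm_def, h3, Real.sqrt_one]
    exact mem_sphere_zero_iff_norm.mpr this⟩

/-- The determinant map `det : U(d) → S¹`, as a continuous map. -/
noncomputable def circleDet (d : ℕ) : C(Matrix.unitaryGroup (Fin d) ℂ, Circle) :=
  ⟨detCircle d, by
    apply Continuous.subtype_mk
    exact continuous_subtype_val.matrix_det⟩


section Algebra
open Matrix
variable {A : Type*} [CommRing A]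

/-- The submonoid generated by transvections. -/
def elemMat (n : ℕ) (A : Type*) [CommRing A] : Submonoid (Matrix (Fin n) (Fin n) A) :=
  Submonoid.closure {M | ∃ i j : Fin n, i ≠ j ∧ ∃ c : A, M = transvection i j c}

lemma transvection_mem_elemMat {n : ℕ} {i j : Fin n} (h : i ≠ j) (c : A) :
    transvection i j c ∈ elemMat n A :=
  Submonoid.subset_closure ⟨i, j, h, c, rfl⟩

lemma elemMat_cancel_left {n : ℕ} {g : Matrix (Fin n) (Fin n) A} (hg : g ∈ elemMat n A) :
    ∀ M, g * M ∈ elemMat n A → M ∈ elemMat n A := by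
  induction hg using Submonoid.closure_induction with
  | mem x hx =>
    obtain ⟨i, j, h, c, rfl⟩ := hx
    intro M hM
    have := mul_mem (transvection_mem_elemMat h (-c)) hM
    rwa [← mul_assoc, transvection_mul_transvection_same _ _ h, neg_add_cancel, transvection_zero,
      one_mul] at this
  | one => intro M hM; simpa using hM
  | mul x y _ _ hx hy => intro M hM; exact hy _ (hx _ (by rwa [← mul_assoc]))

lemma elemMat_cancel_right {n : ℕ} {g : Matrix (Fin n) (Fin n) A} (hg : g ∈ elemMat n A) :
    ∀ M, M * g ∈ elemMat n A → M ∈ elemMat n A := by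
  induction hg using Submonoid.closure_induction with
  | mem x hx =>
    obtain ⟨i, j, h, c, rfl⟩ := hx
    intro M hM
    have := mul_mem hM (transvection_mem_elemMat h (-c))
    rwa [mul_assoc, transvection_mul_transvection_same _ _ h, add_neg_cancel, transvection_zero,
      mul_one] at this
  | one => intro M hM; simpa using hM
  | mul x y _ _ hx hy => intro M hM; exact hx _ (hy _ (by rwa [mul_assoc]))

lemma elemMat_det {n : ℕ} {g : Matrix (Fin n) (Fin n) A} (hg : g ∈ elemMat n A) : g.det = 1 := by
  induction hg using Submonoid.closure_induction with
  | mem x hx =>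
    obtain ⟨i, j, h, c, rfl⟩ := hx
    exact det_transvection_of_ne _ _ h c
  | one => simp
  | mul x y _ _ hx hy => simp [hx, hy]

lemma col_mem_elemMat {n : ℕ} (k : Fin n) (u : Fin n → A) (hu : u k = 0) :
    1 + vecMulVec u (Pi.single k 1) ∈ elemMat n A := by
  have key : ∀ s : Finset (Fin n), k ∉ s → 1 + ∑ i ∈ s, single i k (u i) ∈ elemMat n A := by
    intro s
    induction s using Finset.induction_on with
    | empty => intro _; simp
    | insert a s ha ih =>
      intro hk
      simp only [Finset.mem_insert, not_or] at hk
      have h1 := mul_mem (transvection_mem_elemMat (Ne.symm hk.1) (u a)) (ih hk.2)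
      have h2 : single a k (u a) * ∑ i ∈ s, single i k (u i) = 0 := by
        rw [Finset.mul_sum]
        refine Finset.sum_eq_zero fun i hi => ?_
        apply single_mul_single_of_ne
        rintro rfl; exact hk.2 hi
      rw [transvection, add_mul, one_mul, mul_add, h2, mul_one, add_zero] at h1
      rw [Finset.sum_insert ha]
      convert h1 using 1
      abel
  convert key (Finset.univ.erase k) (by simp) using 2
  ext i j
  simp only [vecMulVec_apply, Matrix.sum_apply, single_apply, Pi.single_apply]
  by_cases hj : j = k
  · subst hj
    by_cases hi : i = j
    · subst hi; simp [hu]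
    · simp [hi]
  · simp [hj, Ne.symm hj]

lemma row_mem_elemMat {n : ℕ} (k : Fin n) (u : Fin n → A) (hu : u k = 0) :
    1 + vecMulVec (Pi.single k 1) u ∈ elemMat n A := by
  have key : ∀ s : Finset (Fin n), k ∉ s → 1 + ∑ i ∈ s, single k i (u i) ∈ elemMat n A := by
    intro s
    induction s using Finset.induction_on with
    | empty => intro _; simp
    | insert a s ha ih =>
      intro hk
      simp only [Finset.mem_insert, not_or] at hk
      have h1 := mul_mem (transvection_mem_elemMat hk.1 (u a)) (ih hk.2)
      have h2 : single k a (u a) * ∑ i ∈ s, single k i (u i) = 0 := by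
        rw [Finset.mul_sum]
        refine Finset.sum_eq_zero fun i hi => ?_
        apply single_mul_single_of_ne
        exact Ne.symm hk.1
      rw [transvection, add_mul, one_mul, mul_add, h2, mul_one, add_zero] at h1
      rw [Finset.sum_insert ha]
      convert h1 using 1
      abel
  convert key (Finset.univ.erase k) (by simp) using 2
  ext i j
  simp only [vecMulVec_apply, Matrix.sum_apply, single_apply, Pi.single_apply]
  by_cases hj : i = k
  · subst hj
    by_cases hi : j = i
    · subst hi; simp [hu]
    · simp [hi]
  · simp [hj, Ne.symm hj]

/-- block embedding `N ↦ 1 ⊕ N`. -/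
def blockOne {n : ℕ} (N : Matrix (Fin n) (Fin n) A) : Matrix (Fin (n + 1)) (Fin (n + 1)) A :=
  fun i j => Fin.cases (Fin.cases (1 : A) (fun _ => 0) j)
    (fun i' => Fin.cases (0 : A) (fun j' => N i' j') j) i

lemma blockOne_mem {n : ℕ} {N : Matrix (Fin n) (Fin n) A} (hN : N ∈ elemMat n A) :
    blockOne N ∈ elemMat (n + 1) A := by
  have h1 : blockOne (1 : Matrix (Fin n) (Fin n) A) = 1 := by
    ext i j
    refine Fin.cases ?_ (fun i => ?_) i <;> refine Fin.cases ?_ (fun j => ?_) j <;>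
      simp [blockOne, one_apply, Fin.succ_ne_zero, (Fin.succ_ne_zero _).symm]
  induction hN using Submonoid.closure_induction with
  | mem x hx =>
    obtain ⟨i, j, h, c, rfl⟩ := hx
    have : blockOne (transvection i j c) = transvection i.succ j.succ c := by
      ext a b
      refine Fin.cases ?_ (fun a => ?_) a <;> refine Fin.cases ?_ (fun b => ?_) b <;>
      simp [blockOne, transvection, one_apply, single_apply, Fin.succ_ne_zero,
        (Fin.succ_ne_zero _).symm]
    rw [this]
    exact transvection_mem_elemMat (by simpa using h) c
  | one => rw [h1]; exact one_mem _
  | mul x y _ _ hx hy =>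
    have : blockOne (x * y) = blockOne x * blockOne y := by
      ext a b
      refine Fin.cases ?_ (fun a => ?_) a <;> refine Fin.cases ?_ (fun b => ?_) b <;>
      simp [blockOne, mul_apply, Fin.sum_univ_succ]
    rw [this]; exact mul_mem hx hy

lemma blockOne_det {n : ℕ} (N : Matrix (Fin n) (Fin n) A) : (blockOne N).det = N.det := by
  rw [det_succ_row_zero, Fin.sum_univ_succ]
  have : (blockOne N).submatrix Fin.succ Fin.succ = N := by
    ext i j; simp [blockOne]
  simp [blockOne] at this ⊢
  rw [this]

theorem mem_elemMat_of_det_eq_one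
    (hsr : ∀ a b x y : A, x * a + y * b = 1 → ∃ c, IsUnit (a + c * b)) :
    ∀ (n : ℕ) (M : Matrix (Fin n) (Fin n) A), M.det = 1 → M ∈ elemMat n A := by
  intro n
  induction n with
  | zero => intro M _; rw [Subsingleton.elim M 1]; exact one_mem _
  | succ n ih =>
    -- the case where the corner is one
    have corner : ∀ M : Matrix (Fin (n + 1)) (Fin (n + 1)) A, M.det = 1 → M 0 0 = 1 →
        M ∈ elemMat (n + 1) A := by
      intro M hM h00
      have hc := col_mem_elemMat (A := A) (0 : Fin (n + 1)) (Fin.cons 0 fun i => - M i.succ 0) rfl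
      refine elemMat_cancel_left hc _ ?_
      have hr := row_mem_elemMat (A := A) (0 : Fin (n + 1)) (Fin.cons 0 fun i => - M 0 i.succ) rfl
      refine elemMat_cancel_right hr _ ?_
      have hd : ∀ X, X = (1 + vecMulVec (Fin.cons 0 fun i => - M i.succ 0) (Pi.single 0 1)) * M *
        (1 + vecMulVec (Pi.single 0 1) (Fin.cons 0 fun i => - M 0 i.succ)) → X.det = 1 := by
        rintro X rfl
        rw [det_mul, det_mul, elemMat_det hc, elemMat_det hr, hM]; simp
      have hb : blockOne (Matrix.of fun i j => M i.succ j.succ - M i.succ 0 * M 0 j.succ) =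
        (1 + vecMulVec (Fin.cons 0 fun i => - M i.succ 0) (Pi.single 0 1)) * M *
        (1 + vecMulVec (Pi.single 0 1) (Fin.cons 0 fun i => - M 0 i.succ)) := by
        rw [add_mul, mul_add, one_mul, mul_one, vecMulVec_mul, mul_vecMulVec, add_mulVec]
        ext a b
        refine Fin.cases ?_ (fun a => ?_) a <;> refine Fin.cases ?_ (fun b => ?_) b <;>
        simp [blockOne, vecMulVec_apply, h00] <;> ring
      have h1 := hd _ hb
      rw [blockOne_det] at h1
      rw [← hb]
      exact blockOne_mem (ih _ h1)
    intro M hM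
    cases n with
    | zero => exact corner M hM (by simpa using hM)
    | succ n =>
      have hx : ∑ i, M.adjugate 0 i * M i 0 = 1 := by
        have := congrFun (congrFun (adjugate_mul M) 0) 0
        simpa [mul_apply, hM] using this
      rw [Fin.sum_univ_succ] at hx
      obtain ⟨c, hc⟩ := hsr (M 0 0) (∑ i : Fin (n + 1), M.adjugate 0 i.succ * M i.succ 0)
        (M.adjugate 0 0) 1 (by rw [one_mul]; exact hx)
      have hr := row_mem_elemMat (A := A) (0 : Fin (n + 2))
        (Fin.cons 0 fun i => c * M.adjugate 0 i.succ) rfl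
      obtain ⟨R, hR⟩ : ∃ R : Matrix (Fin (n + 2)) (Fin (n + 2)) A, R = 1 + vecMulVec (Pi.single 0 1)
        (Fin.cons 0 fun i => c * M.adjugate 0 i.succ) := ⟨_, rfl⟩
      rw [← hR] at hr
      refine elemMat_cancel_left hr _ ?_
      have hd : det (R * M) = 1 := by
        rw [det_mul, elemMat_det hr, hM, one_mul]
      have hu : IsUnit ((R * M) 0 0) := by
        convert hc using 1
        rw [hR, add_mul, vecMulVec_mul]
        simp [vecMulVec_apply, vecMul, dotProduct, Fin.sum_univ_succ (n := n + 1), Finset.mul_sum,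
          mul_assoc]
      generalize R * M = P at hd hu ⊢
      obtain ⟨w, hw⟩ := hu.exists_left_inv
      have h10 : (1 : Fin (n + 2)) ≠ 0 := by simp
      have t1 := transvection_mem_elemMat h10 ((1 - P 1 0) * w)
      refine elemMat_cancel_left t1 _ ?_
      have h1 : (transvection (1 : Fin (n + 2)) 0 ((1 - P 1 0) * w) * P) 1 0 = 1 := by
        rw [transvection_mul_apply_same, mul_assoc, hw]; ring
      have hd' : (transvection (1 : Fin (n + 2)) 0 ((1 - P 1 0) * w) * P).det = 1 := by
        rw [det_mul, elemMat_det t1, hd, one_mul]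
      generalize transvection (1 : Fin (n + 2)) 0 ((1 - P 1 0) * w) * P = Q at h1 hd' ⊢
      have t2 := transvection_mem_elemMat h10.symm (1 - Q 0 0)
      refine elemMat_cancel_left t2 _ (corner _ ?_ ?_)
      · rw [det_mul, elemMat_det t2, hd', one_mul]
      · rw [transvection_mul_apply_same, h1]; ring

end Algebra

section Analysis

lemma circle_approx (f : C(Circle, ℂ)) (ε : ℝ) (hε : 0 < ε) :
    ∃ g : C(Circle, ℂ), IsUnit g ∧ ‖g - f‖ < ε := by
  have : Fact (0 < 2 * Real.pi) := ⟨Real.two_pi_pos⟩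
  let e : AddCircle (2 * Real.pi) ≃ₜ Circle := AddCircle.homeomorphCircle'
  let F : C(AddCircle (2 * Real.pi), ℂ) := f.comp ⟨e, e.continuous⟩
  have hF : F ∈ (Submodule.span ℂ (Set.range <| @fourier (2 * Real.pi))).topologicalClosure := by
    rw [span_fourier_closure_eq_top]; trivial
  rw [← SetLike.mem_coe, Submodule.topologicalClosure_coe, Metric.mem_closure_iff] at hF
  obtain ⟨P, hP, hPF⟩ := hF (ε / 2) (half_pos hε)
  have hsm : ContDiff ℝ 1 (fun x : ℝ => P (x : AddCircle (2 * Real.pi))) := by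
    clear hPF
    induction hP using Submodule.span_induction with
    | mem x hx =>
      obtain ⟨n, rfl⟩ := hx
      simp only [fourier_coe_apply]
      have : ContDiff ℝ 1 (fun x : ℝ => (x : ℂ)) := Complex.ofRealCLM.contDiff
      exact ((contDiff_const.mul this).div_const _).cexp
    | zero => simpa using contDiff_const
    | add x y _ _ hx hy => exact hx.add hy
    | smul a x _ hx => exact hx.const_smul a
  have hdense := hsm.dense_compl_range_of_finrank_lt_finrank (by simp)
  obtain ⟨c, hc, hcε⟩ := hdense.exists_dist_lt 0 (half_pos hε)
  let g : C(Circle, ℂ) := (P - ContinuousMap.const _ c).comp ⟨e.symm, e.symm.continuous⟩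
  refine ⟨g, ?_, ?_⟩
  · rw [ContinuousMap.isUnit_iff_forall_ne_zero]
    intro z hz
    obtain ⟨x, hx⟩ := QuotientAddGroup.mk_surjective (e.symm z)
    apply hc
    refine ⟨x, ?_⟩
    have h2 : P (e.symm z) - c = 0 := hz
    rw [← hx] at h2
    exact sub_eq_zero.1 h2
  · rw [ContinuousMap.norm_lt_iff _ hε]
    intro z
    have h1 : dist (F (e.symm z)) (P (e.symm z)) < ε / 2 :=
      (ContinuousMap.dist_apply_le_dist _).trans_lt hPF
    have h2 : F (e.symm z) = f z := by simp [F]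
    rw [h2, dist_comm, dist_eq_norm] at h1
    rw [dist_comm, dist_zero_right] at hcε
    have h3 : (g - f) z = (P (e.symm z) - f z) - c := by
      simp [g]; ring
    rw [h3]
    calc _ ≤ ‖P (e.symm z) - f z‖ + ‖c‖ := norm_sub_le _ _
      _ < ε := by linarith

lemma circle_sr (a b x y : C(Circle, ℂ)) (h : x * a + y * b = 1) :
    ∃ c, IsUnit (a + c * b) := by
  obtain ⟨g, hg, hgx⟩ := circle_approx x (1 / (‖a‖ + 1)) (by positivity)
  have hu : IsUnit (g * a + y * b) := by
    have h1 : g * a + y * b = 1 - (x - g) * a := by rw [← h]; ring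
    rw [h1]
    apply isUnit_one_sub_of_norm_lt_one
    have h2 : ‖x - g‖ < 1 / (‖a‖ + 1) := by rwa [norm_sub_rev]
    calc ‖(x - g) * a‖ ≤ ‖x - g‖ * ‖a‖ := norm_mul_le _ _
      _ ≤ 1 / (‖a‖ + 1) * ‖a‖ := by gcongr
      _ < 1 := by
        rw [one_div, inv_mul_lt_iff₀ (by positivity)]; linarith
  obtain ⟨w, hw⟩ := hg.exists_left_inv
  refine ⟨w * y, ?_⟩
  have hwu : IsUnit w := IsUnit.of_mul_eq_one _ hw
  have : a + w * y * b = w * (g * a + y * b) := by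
    rw [mul_add, ← mul_assoc, hw]; ring
  rw [this]; exact hwu.mul hu

open Matrix InnerProductSpace

/-- Columns of a matrix, as Euclidean vectors. -/
noncomputable def matCols {d : ℕ} (M : Matrix (Fin d) (Fin d) ℂ) (j : Fin d) :
    EuclideanSpace ℂ (Fin d) := WithLp.toLp 2 (fun i => M i j)

lemma matCols_li {d : ℕ} (M : Matrix (Fin d) (Fin d) ℂ) (h : M.det = 1) :
    LinearIndependent ℂ (matCols M) := by
  have h1 : LinearIndependent ℂ M.col := by
    rw [Matrix.linearIndependent_cols_iff_isUnit, Matrix.isUnit_iff_isUnit_det, h]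
    exact isUnit_one
  exact h1.map' (WithLp.linearEquiv 2 ℂ (Fin d → ℂ)).symm.toLinearMap (LinearEquiv.ker _)

lemma gs_continuous {d : ℕ} (j : Fin d) :
    Continuous (fun M : {M : Matrix (Fin d) (Fin d) ℂ // M.det = 1} =>
      gramSchmidt ℂ (matCols M.1) j) := by
  induction j using WellFoundedLT.induction with
  | ind j ih =>
    have : ∀ i : Fin d, Continuous (fun M : {M : Matrix (Fin d) (Fin d) ℂ // M.det = 1} =>
      matCols M.1 i) := by
      intro i
      apply (PiLp.continuous_toLp 2 _).comp
      exact continuous_pi fun k => continuous_subtype_val.matrix_elem k i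
    simp_rw [gramSchmidt_def ℂ _ j, Submodule.starProjection_singleton]
    refine (this j).sub (continuous_finsetSum _ fun i hi => ?_)
    have hi' := ih i (Finset.mem_Iio.1 hi)
    suffices hs : Continuous (fun M : {M : Matrix (Fin d) (Fin d) ℂ // M.det = 1} =>
        inner ℂ (gramSchmidt ℂ (matCols M.1) i) (matCols M.1 j) /
          ((‖gramSchmidt ℂ (matCols M.1) i‖ ^ 2 : ℝ) : ℂ)) from hs.smul hi'
    refine Continuous.div (Continuous.inner (𝕜 := ℂ) hi' (this j)) ?_ ?_
    · fun_prop
    · intro M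
      have := gramSchmidt_ne_zero (𝕜 := ℂ) i (matCols_li M.1 M.2)
      simpa using this

lemma gsn_continuous {d : ℕ} (j : Fin d) :
    Continuous (fun M : {M : Matrix (Fin d) (Fin d) ℂ // M.det = 1} =>
      gramSchmidtNormed ℂ (matCols M.1) j) := by
  unfold gramSchmidtNormed
  suffices hs : Continuous (fun M : {M : Matrix (Fin d) (Fin d) ℂ // M.det = 1} =>
      (‖gramSchmidt ℂ (matCols M.1) j‖ : ℂ)⁻¹) from hs.smul (gs_continuous j)
  refine Continuous.inv₀ ?_ ?_
  · have := gs_continuous j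
    fun_prop
  · intro M
    have := gramSchmidt_ne_zero (𝕜 := ℂ) j (matCols_li M.1 M.2)
    simpa using this

lemma cols_orthonormal_iff {d : ℕ} (M : Matrix (Fin d) (Fin d) ℂ) :
    Orthonormal ℂ (matCols M) ↔ M ∈ Matrix.unitaryGroup (Fin d) ℂ := by
  rw [Matrix.mem_unitaryGroup_iff', orthonormal_iff_ite, ← Matrix.ext_iff]
  refine forall_congr' fun i => forall_congr' fun j => ?_
  have : inner ℂ (matCols M i) (matCols M j) = (star M * M) i j := by
    simp [matCols, Matrix.mul_apply, PiLp.inner_apply, Matrix.star_apply, mul_comm]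
  rw [this, Matrix.one_apply]

lemma exists_retraction (d : ℕ) :
    ∃ r : {M : Matrix (Fin d) (Fin d) ℂ // M.det = 1} → Matrix.unitaryGroup (Fin d) ℂ,
      Continuous r ∧ ∀ (u : Matrix.unitaryGroup (Fin d) ℂ) (h : u.1.det = 1), r ⟨u.1, h⟩ = u := by
  have hcol : ∀ M : Matrix (Fin d) (Fin d) ℂ,
      matCols (Matrix.of fun i j => gramSchmidtNormed ℂ (matCols M) j i)
        = gramSchmidtNormed ℂ (matCols M) := by
    intro M; ext j i; simp [matCols]
  refine ⟨fun M => ⟨Matrix.of fun i j => gramSchmidtNormed ℂ (matCols M.1) j i, ?_⟩, ?_, ?_⟩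
  · rw [← cols_orthonormal_iff, hcol]
    exact gramSchmidtNormed_orthonormal (matCols_li M.1 M.2)
  · apply Continuous.subtype_mk
    refine continuous_matrix fun i j => ?_
    have := gsn_continuous j
    exact (PiLp.continuous_apply 2 _ i).comp this
  · intro u h
    apply Subtype.ext
    have ho := (cols_orthonormal_iff u.1).2 u.2
    have h1 : gramSchmidt ℂ (matCols u.1) = matCols u.1 :=
      gramSchmidt_of_orthogonal ℂ ho.2
    ext i j
    simp [gramSchmidtNormed, h1, ho.1 j]
    simp [matCols]

end Analysis
section Main
open Matrix unitInterval

lemma elem_path {n : ℕ} {M : Matrix (Fin n) (Fin n) C(Circle, ℂ)} (hM : M ∈ elemMat n _) :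
    ∃ H : I → Matrix (Fin n) (Fin n) C(Circle, ℂ), Continuous H ∧ (∀ s, (H s).det = 1) ∧
      H 0 = 1 ∧ H 1 = M := by
  induction hM using Submonoid.closure_induction with
  | mem x hx =>
    obtain ⟨i, j, h, c, rfl⟩ := hx
    refine ⟨fun s => transvection i j (((s : ℝ) : ℂ) • c), ?_, ?_, ?_, ?_⟩
    · unfold transvection
      refine continuous_const.add (continuous_matrix fun a b => ?_)
      simp only [single_apply]
      split_ifs
      · fun_prop
      · exact continuous_const
    · intro s; exact det_transvection_of_ne _ _ h _
    · simp
    · simp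
  | one => exact ⟨fun _ => 1, continuous_const, by simp, rfl, rfl⟩
  | mul x y _ _ hx hy =>
    obtain ⟨H, h1, h2, h3, h4⟩ := hx
    obtain ⟨K, k1, k2, k3, k4⟩ := hy
    exact ⟨fun s => H s * K s, h1.mul k1, by simp [h2, k2], by simp [h3, k3], by simp [h4, k4]⟩

/-- Evaluation at a point, as a ring homomorphism. -/
noncomputable def evalHom (z : Circle) : C(Circle, ℂ) →+* ℂ :=
  (Pi.evalRingHom (fun _ : Circle => ℂ) z).comp ContinuousMap.coeFnRingHom

lemma evalHom_apply (z : Circle) (f : C(Circle, ℂ)) : evalHom z f = f z := rfl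

lemma homotopic_one_of_det {d : ℕ} (N : C(Circle, Matrix.unitaryGroup (Fin d) ℂ))
    (hN : ∀ z, (N z).1.det = 1) : ContinuousMap.Homotopic (ContinuousMap.const _ 1) N := by
  let M : Matrix (Fin d) (Fin d) C(Circle, ℂ) := Matrix.of fun i j =>
    ⟨fun z => (N z).1 i j, (continuous_subtype_val.comp N.continuous).matrix_elem i j⟩
  have hMz : ∀ z, M.map (evalHom z) = (N z).1 := fun z => by ext i j; rfl
  have hM : M.det = 1 := by
    ext z
    change evalHom z M.det = 1
    rw [RingHom.map_det, RingHom.mapMatrix_apply, hMz, hN]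
  obtain ⟨H, h1, h2, h3, h4⟩ := elem_path (mem_elemMat_of_det_eq_one circle_sr d M hM)
  obtain ⟨r, hr, hru⟩ := exists_retraction d
  have hdet : ∀ s z, ((H s).map (evalHom z)).det = 1 := by
    intro s z
    rw [← RingHom.mapMatrix_apply, ← RingHom.map_det, h2, map_one]
  refine ⟨⟨⟨fun p => r ⟨(H p.1).map (evalHom p.2), hdet _ _⟩, ?_⟩, ?_, ?_⟩⟩
  · refine hr.comp (Continuous.subtype_mk (continuous_matrix fun i j => ?_) _)
    simp only [Matrix.map_apply, evalHom_apply]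
    have : Continuous fun s => H s i j := h1.matrix_elem i j
    fun_prop
  · intro z
    have : (H 0).map (evalHom z) = (1 : Matrix.unitaryGroup (Fin d) ℂ).1 := by
      rw [h3]; simp
    simp only [this]
    exact hru _ _
  · intro z
    have : (H 1).map (evalHom z) = (N z).1 := by rw [h4, hMz]
    simp only [this]
    exact hru _ _

lemma homotopic_mul {X G : Type*} [TopologicalSpace X] [TopologicalSpace G] [Mul G]
    [ContinuousMul G] {f f' g g' : C(X, G)} (h : f.Homotopic f') (k : g.Homotopic g') :
    (f * g).Homotopic (f' * g') := by
  let m : C(G × G, G) := ⟨fun p => p.1 * p.2, continuous_mul⟩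
  exact (ContinuousMap.Homotopic.refl m).comp (h.prodMk k)

lemma homotopic_const {X Y : Type*} [TopologicalSpace X] [TopologicalSpace Y]
    [PathConnectedSpace Y] (a b : Y) :
    (ContinuousMap.const X a).Homotopic (ContinuousMap.const X b) := by
  let p := (PathConnectedSpace.joined a b).somePath
  exact ⟨⟨⟨fun q => p q.1, by fun_prop⟩, by simp, by simp⟩⟩

/-- The unitary matrix `diag(u, 1, …, 1)`. -/
noncomputable def diagU (d : ℕ) : C(Circle, Matrix.unitaryGroup (Fin (d + 1)) ℂ) where
  toFun u := ⟨Matrix.diagonal (Fin.cons (u : ℂ) fun _ => 1), by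
    rw [Matrix.mem_unitaryGroup_iff, Matrix.star_eq_conjTranspose, Matrix.diagonal_conjTranspose,
      Matrix.diagonal_mul_diagonal, ← Matrix.diagonal_one]
    congr 1
    ext i
    refine Fin.cases ?_ (fun i => ?_) i
    · simp [Complex.mul_conj]
    · simp⟩
  continuous_toFun := by
    apply Continuous.subtype_mk
    apply Continuous.matrix_diagonal
    refine continuous_pi fun i => ?_
    refine Fin.cases ?_ (fun i => ?_) i
    · exact (continuous_subtype_val : Continuous fun u : Circle => (u : ℂ))
    · simpa using continuous_const

lemma detCircle_mul {d : ℕ} (u v : Matrix.unitaryGroup (Fin d) ℂ) :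
    detCircle d (u * v) = detCircle d u * detCircle d v := by
  apply Circle.ext
  rw [Circle.coe_mul]
  exact Matrix.det_mul _ _

lemma detCircle_diagU {d : ℕ} (u : Circle) : detCircle (d + 1) (diagU d u) = u := by
  apply Circle.ext; simp [detCircle, diagU, Fin.prod_univ_succ]

/-- The determinant as a group homomorphism. -/
noncomputable def detHom (d : ℕ) : Matrix.unitaryGroup (Fin d) ℂ →* Circle :=
  MonoidHom.mk' (detCircle d) detCircle_mul

lemma homotopic_diagU {d : ℕ} (α : C(Circle, Matrix.unitaryGroup (Fin (d + 1)) ℂ)) :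
    ContinuousMap.Homotopic α ((diagU d).comp ((circleDet (d + 1)).comp α)) := by
  set D := (diagU d).comp ((circleDet (d + 1)).comp α) with hD
  have h1 := homotopic_one_of_det (α * D⁻¹) (by
    intro z
    have h : detHom (d + 1) (α z * (D z)⁻¹) = 1 := by
      rw [map_mul, map_inv, mul_inv_eq_one]
      exact (detCircle_diagU _).symm
    exact congrArg (fun c : Circle => (c : ℂ)) h)
  have h2 := homotopic_mul h1.symm (ContinuousMap.Homotopic.refl D)
  rw [inv_mul_cancel_right] at h2
  convert h2 using 1
  ext1 z
  simp

lemma homotopic_of_det {d : ℕ} (hd : 1 ≤ d) (α β : C(Circle, Matrix.unitaryGroup (Fin d) ℂ))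
    (h : ContinuousMap.Homotopic ((circleDet d).comp α) ((circleDet d).comp β)) :
    ContinuousMap.Homotopic α β := by
  obtain ⟨d, rfl⟩ : ∃ e, d = e + 1 := ⟨d - 1, by omega⟩
  exact (homotopic_diagU α).trans
    (((ContinuousMap.Homotopic.refl (diagU d)).comp h).trans (homotopic_diagU β).symm)

/-- The map `[u] ↦ det uᵢ / det uⱼ` on the quotient. -/
noncomputable def quotDet (q d : ℕ) (i j : Fin q) :
    C((Fin q → Matrix.unitaryGroup (Fin d) ℂ) ⧸ diagonalUnitary q d, Circle) where
  toFun := Quotient.lift (fun u => detCircle d (u i) * (detCircle d (u j))⁻¹) (by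
    intro a b hab
    rw [← Quotient.eq_iff_equiv] at hab
    obtain ⟨v, hv⟩ := QuotientGroup.eq.1 hab
    have hb : b = a * fun _ => v := by rw [← hv]; simp
    subst hb
    simp only [Pi.mul_apply, detCircle_mul, mul_inv]
    rw [mul_mul_mul_comm, mul_inv_cancel, mul_one])
  continuous_toFun := by
    apply Continuous.quotient_lift
    exact ((circleDet d).continuous.comp (continuous_apply i)).mul
      ((circleDet d).continuous.comp (continuous_apply j)).inv

end Main

/-- For `q, d ≥ 1` and a continuous loop `γ = (γ₁, …, γ_q) : S¹ → U(d)^q`, the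
composite of `γ` with the quotient map `U(d)^q → U(d)^q/ΔU(d)` is nullhomotopic if and only if
the winding numbers of the loops `det∘γ₁, …, det∘γ_q : S¹ → S¹` are all equal — the winding
number being the classifier of (free) homotopy classes of circle-valued loops, equality of the
winding numbers of `det∘γᵢ` and `det∘γⱼ` is expressed as homotopy of these two loops. -/
theorem quotient_loop_nullhomotopic_iff_windings_equal (q d : ℕ) (hq : 1 ≤ q) (hd : 1 ≤ d)
    (γ : Fin q → C(Circle, Matrix.unitaryGroup (Fin d) ℂ)) :
    ContinuousMap.Nullhomotopic
      (⟨fun z => (QuotientGroup.mk (fun i => γ i z)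
          : (Fin q → Matrix.unitaryGroup (Fin d) ℂ) ⧸ diagonalUnitary q d),
        QuotientGroup.continuous_mk.comp (continuous_pi fun i => (γ i).continuous)⟩
        : C(Circle, (Fin q → Matrix.unitaryGroup (Fin d) ℂ) ⧸ diagonalUnitary q d))
      ↔ ∀ i j : Fin q,
          ContinuousMap.Homotopic ((circleDet d).comp (γ i)) ((circleDet d).comp (γ j)) := by
  constructor
  · rintro ⟨y, hy⟩ i j
    have h1 := (ContinuousMap.Homotopic.refl (quotDet q d i j)).comp hy
    have h2 := homotopic_mul h1 (ContinuousMap.Homotopic.refl ((circleDet d).comp (γ j)))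
    have h3 := homotopic_mul (homotopic_const (X := Circle) (quotDet q d i j y) 1)
      (ContinuousMap.Homotopic.refl ((circleDet d).comp (γ j)))
    convert h2.trans h3 using 1
    · ext1 z
      exact (inv_mul_cancel_right (detCircle d (γ i z)) (detCircle d (γ j z))).symm
    · ext1 z
      exact (one_mul _).symm
  · intro h
    let i₀ : Fin q := ⟨0, hq⟩
    refine ⟨QuotientGroup.mk 1, ?_⟩
    have h1 := ContinuousMap.Homotopic.pi (f₀ := γ) (f₁ := fun _ => γ i₀)
      fun i => homotopic_of_det hd _ _ (h i i₀)
    let π : C(Fin q → Matrix.unitaryGroup (Fin d) ℂ,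
      (Fin q → Matrix.unitaryGroup (Fin d) ℂ) ⧸ diagonalUnitary q d) :=
      ⟨QuotientGroup.mk, QuotientGroup.continuous_mk⟩
    have h2 := (ContinuousMap.Homotopic.refl π).comp h1
    refine h2.trans ?_
    convert ContinuousMap.Homotopic.refl _ using 1
    ext1 z
    change (QuotientGroup.mk 1 : (Fin q → Matrix.unitaryGroup (Fin d) ℂ) ⧸ diagonalUnitary q d) =
      QuotientGroup.mk (fun _ => γ i₀ z)
    refine QuotientGroup.eq.2 ⟨γ i₀ z, ?_⟩
    ext1 i
    simp
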